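/- Fix α > 0 and w > 0. For δ > 0 let h_δ(x) = δ + x²/α, let Π_δ = {(x,y) ∈ ℝ² : |x| < w, 0 < y < h_δ(x)}, and define G(δ) as the infimum of ∫_{Π_δ} ‖∇u‖² dx dy over all functions u : ℝ² → ℝ that are continuously differentiable on an open set containing the closure of Π_δ and satisfy u(x,0) = 0 and u(x, h_δ(x)) = 1 for all x ∈ [−w, w]. Then δ^{1/2}·G(δ) tends to π·√α as δ → 0⁺; equivalently, G(δ) = π·√α·δ^{−1/2}·(1 + o(1)) as δ → 0⁺. -/

import Mathlib

open MeasureTheory Real Filter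

abbrev E2 := EuclideanSpace ℝ (Fin 2)

def neckS (α w δ : ℝ) : Set E2 := {p | |p 0| < w ∧ 0 < p 1 ∧ p 1 < δ + (p 0) ^ 2 / α}

def neckP (q : ℝ × ℝ) : E2 := WithLp.toLp 2 ![q.1, q.2]

lemma neckP_cont : Continuous neckP := by
  unfold neckP
  refine (PiLp.continuous_toLp 2 _).comp ?_
  refine continuous_pi fun i => ?_
  fin_cases i <;> simp <;> fun_prop

noncomputable def neckE : E2 ≃ᵐ ℝ × ℝ :=
  (MeasurableEquiv.toLp 2 (Fin 2 → ℝ)).symm.trans MeasurableEquiv.finTwoArrow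

lemma neckE_mp : MeasurePreserving neckE volume volume :=
  (volume_preserving_finTwoArrow ℝ).comp
    (EuclideanSpace.volume_preserving_symm_measurableEquiv_toLp (Fin 2))

lemma neckE_symm : (neckE.symm : ℝ × ℝ → E2) = neckP := by
  funext q
  apply neckE.injective
  rw [MeasurableEquiv.apply_symm_apply]
  rfl

lemma neck_fubini (α w δ : ℝ) (f : E2 → ℝ)
    (hf : IntegrableOn f (neckS α w δ)) :
    Integrable (fun x => (Set.Ioo (-w) w).indicator
        (fun x => ∫ y in Set.Ioo 0 (δ + x ^ 2 / α), f (neckP (x, y))) x) ∧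
    ∫ p in neckS α w δ, f p = ∫ x in Set.Ioo (-w) w,
      ∫ y in Set.Ioo 0 (δ + x ^ 2 / α), f (neckP (x, y)) := by
  have hS : MeasurableSet (neckS α w δ) := by
    apply IsOpen.measurableSet
    have h0 : Continuous fun p : E2 => p 0 := by fun_prop
    have h1 : Continuous fun p : E2 => p 1 := by fun_prop
    exact (isOpen_lt h0.abs continuous_const).inter
      ((isOpen_lt continuous_const h1).inter
        (isOpen_lt h1 (continuous_const.add ((h0.pow 2).div_const _))))
  have hmp : MeasurePreserving neckP volume volume := by
    rw [← neckE_symm]; exact neckE_mp.symm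
  have hemb : MeasurableEmbedding neckP := by
    rw [← neckE_symm]; exact neckE.symm.measurableEmbedding
  have hi : Integrable ((neckS α w δ).indicator f) := (integrable_indicator_iff hS).2 hf
  have hi2 : Integrable (fun q => (neckS α w δ).indicator f (neckP q)) :=
    (hmp.integrable_comp_emb hemb).2 hi
  have key : ∀ x, ∫ y, (neckS α w δ).indicator f (neckP (x, y)) =
      (Set.Ioo (-w) w).indicator
        (fun x => ∫ y in Set.Ioo 0 (δ + x ^ 2 / α), f (neckP (x, y))) x := by
    intro x
    by_cases hx : x ∈ Set.Ioo (-w) w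
    · rw [Set.indicator_of_mem hx, ← integral_indicator measurableSet_Ioo]
      congr 1
      funext y
      simp only [Set.indicator]
      congr 1
      simp only [neckS, neckP, Set.mem_ofPred_eq, Set.mem_Ioo, eq_iff_iff]
      simp [abs_lt, hx.1, hx.2]
    · rw [Set.indicator_of_notMem hx]
      rw [← integral_zero ℝ ℝ]
      congr 1
      funext y
      apply Set.indicator_of_notMem
      intro h
      exact hx (abs_lt.1 (by simpa [neckP] using h.1))
  constructor
  · have := hi2.integral_prod_left
    simpa only [key] using this
  · rw [← integral_indicator hS, ← hmp.integral_comp hemb, Measure.volume_eq_prod,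
      integral_prod _ hi2]
    simp only [key]
    rw [integral_indicator measurableSet_Ioo]

lemma neck_closure_mem (α w δ : ℝ) (hα : 0 < α) (hδ : 0 < δ) (x y : ℝ)
    (hx : x ∈ Set.Ioo (-w) w) (hy : y ∈ Set.Icc 0 (δ + x ^ 2 / α)) :
    neckP (x, y) ∈ closure (neckS α w δ) := by
  have hH : (0 : ℝ) < δ + x ^ 2 / α := by positivity
  rw [← closure_Ioo hH.ne] at hy
  have hc : Continuous fun y : ℝ => neckP (x, y) := neckP_cont.comp (by fun_prop)
  refine Set.MapsTo.closure (f := fun y : ℝ => neckP (x, y)) ?_ hc hy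
  intro y hy
  exact ⟨by simpa [neckP, abs_lt] using hx, by simpa [neckP] using hy.1,
    by simpa [neckP] using hy.2⟩

lemma neck_compact (α w δ : ℝ) (hα : 0 < α) : IsCompact (closure (neckS α w δ)) := by
  refine IsCompact.closure_of_subset
    (((isCompact_Icc (a := -w) (b := w)).prod
      (isCompact_Icc (a := (0:ℝ)) (b := δ + w ^ 2 / α))).image neckP_cont) ?_
  rintro p ⟨h1, h2, h3⟩
  refine ⟨(p 0, p 1), ⟨⟨(abs_lt.1 h1).1.le, (abs_lt.1 h1).2.le⟩, h2.le, h3.le.trans ?_⟩, ?_⟩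
  · have : (p 0) ^ 2 ≤ w ^ 2 := sq_le_sq' (abs_lt.1 h1).1.le (abs_lt.1 h1).2.le
    simp only; gcongr
  · ext i; fin_cases i <;> simp [neckP]

lemma neck_norm_grad (u : E2 → ℝ) (p : E2) : ‖gradient u p‖ = ‖fderiv ℝ u p‖ := by
  simp [gradient]

lemma neck_I_cont (α δ : ℝ) (hα : 0 < α) (hδ : 0 < δ) :
    Continuous (fun x : ℝ => 1 / (δ + x ^ 2 / α)) := by
  refine continuous_const.div (by fun_prop) fun x => ?_
  positivity

lemma neck_I (α w δ : ℝ) (hα : 0 < α) (hw : 0 < w) (hδ : 0 < δ) :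
    ∫ x in Set.Ioo (-w) w, 1 / (δ + x ^ 2 / α) =
      2 * (√α / √δ) * arctan (w / (√α * √δ)) := by
  rw [← integral_Ioc_eq_integral_Ioo, ← intervalIntegral.integral_of_le (by linarith)]
  have ha : 0 < √α := Real.sqrt_pos.2 hα
  have hs : 0 < √δ := Real.sqrt_pos.2 hδ
  rw [intervalIntegral.integral_eq_sub_of_hasDerivAt
    (f := fun x => (√α / √δ) * arctan (x / (√α * √δ)))]
  · rw [neg_div, arctan_neg]; ring
  · intro x _
    have h := (((hasDerivAt_id x).div_const (√α * √δ)).arctan).const_mul (√α / √δ)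
    refine HasDerivAt.congr_deriv h ?_
    have e1 : α = √α ^ 2 := (Real.sq_sqrt hα.le).symm
    have e2 : δ = √δ ^ 2 := (Real.sq_sqrt hδ.le).symm
    have e3 : δ + x ^ 2 / α = √δ ^ 2 + x ^ 2 / √α ^ 2 := by rw [← e1, ← e2]
    rw [e3]
    simp only [id]
    field_simp
  · exact (neck_I_cont α δ hα hδ).intervalIntegrable _ _

lemma neck_integrable (α w δ : ℝ) (hα : 0 < α) (u : E2 → ℝ) (U : Set E2) (hU : IsOpen U)
    (hSU : closure (neckS α w δ) ⊆ U) (hu : ContDiffOn ℝ 1 u U) :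
    ContinuousOn (fun p => ‖gradient u p‖ ^ 2) U ∧
    IntegrableOn (fun p => ‖gradient u p‖ ^ 2) (neckS α w δ) := by
  have hc : ContinuousOn (fun p => ‖gradient u p‖ ^ 2) U := by
    simp only [neck_norm_grad]
    exact (hu.continuousOn_fderiv_of_isOpen hU le_rfl).norm.pow 2
  exact ⟨hc, ((hc.mono hSU).integrableOn_compact (neck_compact α w δ hα)).mono_set subset_closure⟩

lemma neckP_deriv (x y : ℝ) :
    HasDerivAt (fun y : ℝ => neckP (x, y)) (neckP (0, 1)) y := by
  have : (fun y : ℝ => neckP (x, y)) = fun y => neckP (x, 0) + y • neckP (0, 1) := by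
    funext y
    ext i; fin_cases i <;> simp [neckP]
  rw [this]
  simpa using ((hasDerivAt_id y).smul_const (neckP (0, 1))).const_add (neckP (x, 0))

lemma neckP_norm : ‖neckP (0, 1)‖ = 1 := by
  simp [neckP, EuclideanSpace.norm_eq]

lemma neck_lower (α w δ : ℝ) (hα : 0 < α) (hδ : 0 < δ) (u : E2 → ℝ) (U : Set E2)
    (hU : IsOpen U) (hSU : closure (neckS α w δ) ⊆ U) (hu : ContDiffOn ℝ 1 u U)
    (h0 : ∀ x ∈ Set.Icc (-w) w, u (neckP (x, 0)) = 0)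
    (h1 : ∀ x ∈ Set.Icc (-w) w, u (neckP (x, δ + x ^ 2 / α)) = 1) :
    ∫ x in Set.Ioo (-w) w, 1 / (δ + x ^ 2 / α) ≤ ∫ p in neckS α w δ, ‖gradient u p‖ ^ 2 := by
  obtain ⟨hc, hi⟩ := neck_integrable α w δ hα u U hU hSU hu
  obtain ⟨hi2, heq⟩ := neck_fubini α w δ _ hi
  rw [heq]
  refine setIntegral_mono_on ?_ ((integrable_indicator_iff measurableSet_Ioo).1 hi2)
    measurableSet_Ioo ?_
  · exact ((neck_I_cont α δ hα hδ).continuousOn.integrableOn_compact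
      (isCompact_Icc (a := -w) (b := w))).mono_set Set.Ioo_subset_Icc_self
  intro x hx
  have hH : (0 : ℝ) < δ + x ^ 2 / α := by positivity
  have hx' := Set.Ioo_subset_Icc_self hx
  have h0x := h0 x hx'
  have h1x := h1 x hx'
  have hmem := fun y hy => hSU (neck_closure_mem α w δ hα hδ x y hx hy)
  generalize δ + x ^ 2 / α = H at *
  rw [← integral_Ioc_eq_integral_Ioo, ← intervalIntegral.integral_of_le hH.le]
  have hPc : Continuous fun y : ℝ => neckP (x, y) := neckP_cont.comp (by fun_prop)
  have hcd : ContinuousOn (fun y => fderiv ℝ u (neckP (x, y)) (neckP (0, 1)))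
      (Set.Icc 0 H) :=
    ((hu.continuousOn_fderiv_of_isOpen hU le_rfl).comp hPc.continuousOn hmem).clm_apply
      continuousOn_const
  have hcg : ContinuousOn (fun y => ‖gradient u (neckP (x, y))‖ ^ 2) (Set.Icc 0 H) :=
    hc.comp hPc.continuousOn hmem
  have hid : IntervalIntegrable (fun y => fderiv ℝ u (neckP (x, y)) (neckP (0, 1)))
      volume 0 H := by
    apply ContinuousOn.intervalIntegrable; rwa [Set.uIcc_of_le hH.le]
  have hig : IntervalIntegrable (fun y => ‖gradient u (neckP (x, y))‖ ^ 2) volume 0 H := by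
    apply ContinuousOn.intervalIntegrable; rwa [Set.uIcc_of_le hH.le]
  have hftc : ∫ y in (0:ℝ)..H, fderiv ℝ u (neckP (x, y)) (neckP (0, 1)) = 1 := by
    rw [intervalIntegral.integral_eq_sub_of_hasDerivAt (f := fun y => u (neckP (x, y))) _ hid]
    · simp only [h0x, h1x, sub_zero]
    · intro y hy
      rw [Set.uIcc_of_le hH.le] at hy
      have hd : DifferentiableAt ℝ u (neckP (x, y)) :=
        (hu.differentiableOn (by norm_num)).differentiableAt (hU.mem_nhds (hmem y hy))
      exact hd.hasFDerivAt.comp_hasDerivAt y (neckP_deriv x y)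
  have hlow : ∫ y in (0:ℝ)..H, (2 * (1 / H) * fderiv ℝ u (neckP (x, y)) (neckP (0, 1))
      - (1 / H) ^ 2) = 1 / H := by
    rw [intervalIntegral.integral_sub (hid.const_mul _) (by simp),
      intervalIntegral.integral_const_mul, hftc]
    simp; field_simp; ring
  rw [← hlow]
  refine intervalIntegral.integral_mono_on hH.le ((hid.const_mul _).sub (by simp)) hig ?_
  intro y _
  rw [neck_norm_grad]
  have hb : |fderiv ℝ u (neckP (x, y)) (neckP (0, 1))| ≤ ‖fderiv ℝ u (neckP (x, y))‖ := by
    have := (fderiv ℝ u (neckP (x, y))).le_opNorm (neckP (0, 1))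
    rwa [neckP_norm, mul_one, Real.norm_eq_abs] at this
  have hb2 := pow_le_pow_left₀ (abs_nonneg _) hb 2
  rw [sq_abs] at hb2
  nlinarith [sq_nonneg (fderiv ℝ u (neckP (x, y)) (neckP (0, 1)) - 1 / H)]

noncomputable def neckT (α δ : ℝ) (p : E2) : ℝ := p 1 / (δ + (p 0) ^ 2 / α)

lemma neckT_contDiff (α δ : ℝ) (hα : 0 < α) (hδ : 0 < δ) : ContDiff ℝ 1 (neckT α δ) := by
  unfold neckT
  refine ContDiff.div (by fun_prop) (by fun_prop) fun p => ?_
  positivity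

lemma neckT_bound (α w δ : ℝ) (hα : 0 < α) (hδ : 0 < δ) (p : E2) (hp : p ∈ neckS α w δ) :
    ‖gradient (neckT α δ) p‖ ^ 2 ≤
      (1 / (δ + (p 0) ^ 2 / α)) ^ 2 + (4 / α) * (1 / (δ + (p 0) ^ 2 / α)) := by
  rw [neck_norm_grad]
  have hH : (0 : ℝ) < δ + (p 0) ^ 2 / α := by positivity
  obtain ⟨-, hp1, hp2⟩ := hp
  have hd0 : HasFDerivAt (fun p : E2 => p 0) (EuclideanSpace.proj (𝕜 := ℝ) (0 : Fin 2)) p :=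
    (EuclideanSpace.proj (𝕜 := ℝ) (0 : Fin 2)).hasFDerivAt
  have hd1 : HasFDerivAt (fun p : E2 => p 1) (EuclideanSpace.proj (𝕜 := ℝ) (1 : Fin 2)) p :=
    (EuclideanSpace.proj (𝕜 := ℝ) (1 : Fin 2)).hasFDerivAt
  have hdH : HasFDerivAt (fun p : E2 => δ + (p 0) ^ 2 / α)
      ((2 * p 0 / α) • (EuclideanSpace.proj (𝕜 := ℝ) (0 : Fin 2) : E2 →L[ℝ] ℝ)) p := by
    have h2 : HasDerivAt (fun t : ℝ => δ + t ^ 2 / α) (2 * p 0 / α) (p 0) := by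
      simpa using (((hasDerivAt_id (p 0)).pow 2).div_const α).const_add δ
    exact HasDerivAt.comp_hasFDerivAt (h₂ := fun t : ℝ => δ + t ^ 2 / α)
      (f := fun p : E2 => p 0) p h2 hd0
  have hT := hd1.mul ((hasDerivAt_inv hH.ne').comp_hasFDerivAt p hdH)
  have hTe : neckT α δ = (fun p : E2 => p 1) * (fun y : ℝ => y⁻¹) ∘
      fun p : E2 => δ + (p 0) ^ 2 / α := by
    funext q; simp [neckT, div_eq_mul_inv]
  rw [← hTe] at hT
  have hT' := hT.fderiv
  have hbd : ‖fderiv ℝ (neckT α δ) p‖ ≤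
      √((1 / (δ + (p 0) ^ 2 / α)) ^ 2 + (4 / α) * (1 / (δ + (p 0) ^ 2 / α))) := by
    refine ContinuousLinearMap.opNorm_le_bound _ (Real.sqrt_nonneg _) fun v => ?_
    rw [EuclideanSpace.norm_eq, ← Real.sqrt_mul (by positivity), hT', Real.norm_eq_abs]
    apply Real.abs_le_sqrt
    simp only [Fin.sum_univ_two, Real.norm_eq_abs, sq_abs, Function.comp]
    simp only [add_apply, smul_apply, smul_eq_mul,
      show ∀ i, (EuclideanSpace.proj (𝕜 := ℝ) i : E2 →L[ℝ] ℝ) v = v.ofLp i from fun _ => rfl]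
    have hx : (2 * p 0 / α) ^ 2 ≤ 4 / α * (δ + (p 0) ^ 2 / α) := by
      have : (2 * p 0 / α) ^ 2 = 4 / α * ((p 0) ^ 2 / α) := by field_simp; ring
      rw [this]; gcongr; linarith
    generalize hHH : δ + (p 0) ^ 2 / α = H at *
    generalize 2 * p 0 / α = d at *
    generalize p 1 = y at *
    have ha : (y * d / H ^ 2) ^ 2 ≤ 4 / α * (1 / H) := by
      calc (y * d / H ^ 2) ^ 2 = (y / H) ^ 2 * (d ^ 2 / H ^ 2) := by field_simp
        _ ≤ 1 * ((4 / α * H) / H ^ 2) := by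
          gcongr
          exact pow_le_one₀ (by positivity) ((div_le_one hH).2 hp2.le)
        _ = _ := by field_simp
    have e : y * (-(H ^ 2)⁻¹ * (d * v.ofLp 0)) + H⁻¹ * v.ofLp 1 =
      -(y * d / H ^ 2) * v.ofLp 0 + 1 / H * v.ofLp 1 := by field_simp
    rw [e]
    generalize y * d / H ^ 2 = a at *
    generalize 1 / H = b at *
    nlinarith [sq_nonneg (a * v.ofLp 1 + b * v.ofLp 0), sq_nonneg (v.ofLp 0),
      mul_le_mul_of_nonneg_right ha (add_nonneg (sq_nonneg (v.ofLp 0)) (sq_nonneg (v.ofLp 1)))]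
  calc _ ≤ _ := pow_le_pow_left₀ (norm_nonneg _) hbd 2
    _ = _ := Real.sq_sqrt (by positivity)

lemma neck_upper (α w δ : ℝ) (hα : 0 < α) (hw : 0 < w) (hδ : 0 < δ) :
    ∫ p in neckS α w δ, ‖gradient (neckT α δ) p‖ ^ 2 ≤
      (∫ x in Set.Ioo (-w) w, 1 / (δ + x ^ 2 / α)) + 8 * w / α := by
  obtain ⟨-, hi⟩ := neck_integrable α w δ hα (neckT α δ) Set.univ isOpen_univ
    (Set.subset_univ _) (neckT_contDiff α δ hα hδ).contDiffOn
  have hI := neck_I_cont α δ hα hδ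
  have h0 : Continuous fun p : E2 => p 0 := by fun_prop
  have hg : Continuous fun p : E2 =>
      (1 / (δ + (p 0) ^ 2 / α)) ^ 2 + (4 / α) * (1 / (δ + (p 0) ^ 2 / α)) :=
    ((hI.comp h0).pow 2).add (continuous_const.mul (hI.comp h0))
  have hgi : IntegrableOn (fun p : E2 =>
      (1 / (δ + (p 0) ^ 2 / α)) ^ 2 + (4 / α) * (1 / (δ + (p 0) ^ 2 / α))) (neckS α w δ) :=
    (hg.continuousOn.integrableOn_compact (neck_compact α w δ hα)).mono_set subset_closure
  have hS : MeasurableSet (neckS α w δ) := by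
    apply IsOpen.measurableSet
    have h1 : Continuous fun p : E2 => p 1 := by fun_prop
    exact (isOpen_lt h0.abs continuous_const).inter
      ((isOpen_lt continuous_const h1).inter
        (isOpen_lt h1 (continuous_const.add ((h0.pow 2).div_const _))))
  refine (setIntegral_mono_on hi hgi hS (neckT_bound α w δ hα hδ)).trans ?_
  rw [(neck_fubini α w δ _ hgi).2]
  have hin : ∀ x : ℝ, ∫ y in Set.Ioo 0 (δ + x ^ 2 / α),
      ((1 / (δ + (neckP (x, y) 0) ^ 2 / α)) ^ 2 +
        (4 / α) * (1 / (δ + (neckP (x, y) 0) ^ 2 / α))) = 1 / (δ + x ^ 2 / α) + 4 / α := by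
    intro x
    have hH : (0 : ℝ) < δ + x ^ 2 / α := by positivity
    have : ∀ y, neckP (x, y) 0 = x := fun y => by simp [neckP]
    simp only [this]
    generalize δ + x ^ 2 / α = H at *
    rw [setIntegral_const, Real.volume_real_Ioo_of_le hH.le, smul_eq_mul]
    field_simp
    ring
  simp only [hin]
  rw [integral_add]
  · rw [setIntegral_const, Real.volume_real_Ioo_of_le (by linarith), smul_eq_mul]
    apply le_of_eq; ring
  · exact (hI.continuousOn.integrableOn_compact
      (isCompact_Icc (a := -w) (b := w))).mono_set Set.Ioo_subset_Icc_self
  · exact integrableOn_const (by simp)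



/-- Blow-up of the 2D model neck energy: with `h_δ(x) = δ + x²/α`,
`Π_δ = {|x| < w, 0 < y < h_δ(x)}`, and `G(δ)` the infimum of the Dirichlet energy
`∫_{Π_δ} ‖∇u‖²` over all `u` that are `C¹` on an open neighborhood of the closure of
`Π_δ` with `u = 0` on the lower arc and `u = 1` on the upper arc, one has
`δ^{1/2} · G(δ) → π √α` as `δ → 0⁺`. -/
theorem neck_energy_blowup_2d (α w : ℝ) (hα : 0 < α) (hw : 0 < w) (G : ℝ → ℝ)
    (hG : ∀ δ : ℝ, 0 < δ →
      G δ = sInf {e : ℝ |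
        ∃ (u : EuclideanSpace ℝ (Fin 2) → ℝ) (U : Set (EuclideanSpace ℝ (Fin 2))),
          IsOpen U ∧
          closure {p : EuclideanSpace ℝ (Fin 2) |
            |p 0| < w ∧ 0 < p 1 ∧ p 1 < δ + (p 0) ^ 2 / α} ⊆ U ∧
          ContDiffOn ℝ 1 u U ∧
          (∀ x ∈ Set.Icc (-w) w,
            u ((WithLp.equiv 2 (Fin 2 → ℝ)).symm ![x, 0]) = 0) ∧
          (∀ x ∈ Set.Icc (-w) w,
            u ((WithLp.equiv 2 (Fin 2 → ℝ)).symm ![x, δ + x ^ 2 / α]) = 1) ∧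
          e = ∫ p in {p : EuclideanSpace ℝ (Fin 2) |
              |p 0| < w ∧ 0 < p 1 ∧ p 1 < δ + (p 0) ^ 2 / α},
              ‖gradient u p‖ ^ 2}) :
    Tendsto (fun δ : ℝ => δ ^ ((1 : ℝ) / 2) * G δ)
      (nhdsWithin 0 (Set.Ioi 0)) (nhds (Real.pi * Real.sqrt α)) := by

  have hlo : ∀ δ : ℝ, 0 < δ → ∫ x in Set.Ioo (-w) w, 1 / (δ + x ^ 2 / α) ≤ G δ := by
    intro δ hδ
    rw [hG δ hδ]
    apply le_csInf
    · refine ⟨_, neckT α δ, Set.univ, isOpen_univ, Set.subset_univ _,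
        (neckT_contDiff α δ hα hδ).contDiffOn, ?_, ?_, rfl⟩
      · intro x _; simp [neckT]
      · intro x _
        have hH : (0 : ℝ) < δ + x ^ 2 / α := by positivity
        simp [neckT, hH.ne']
    · rintro e ⟨u, U, hU, hSU, hu, h0, h1, rfl⟩
      exact neck_lower α w δ hα hδ u U hU hSU hu h0 h1
  have hup : ∀ δ : ℝ, 0 < δ →
      G δ ≤ (∫ x in Set.Ioo (-w) w, 1 / (δ + x ^ 2 / α)) + 8 * w / α := by
    intro δ hδ
    rw [hG δ hδ]
    refine (csInf_le ?_ ?_).trans (neck_upper α w δ hα hw hδ)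
    · refine ⟨0, ?_⟩
      rintro e ⟨u, U, hU, hSU, hu, h0, h1, rfl⟩
      exact integral_nonneg fun p => by positivity
    · refine ⟨neckT α δ, Set.univ, isOpen_univ, Set.subset_univ _,
        (neckT_contDiff α δ hα hδ).contDiffOn, ?_, ?_, rfl⟩
      · intro x _; simp [neckT]
      · intro x _
        have hH : (0 : ℝ) < δ + x ^ 2 / α := by positivity
        simp [neckT, hH.ne']
  have ha : 0 < √α := Real.sqrt_pos.2 hα
  have hs0 : Tendsto (fun δ : ℝ => √δ) (nhdsWithin 0 (Set.Ioi 0)) (nhds 0) := by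
    have := (Real.continuous_sqrt.tendsto 0).mono_left
      (nhdsWithin_le_nhds (s := Set.Ioi (0:ℝ)))
    simpa using this
  have hpos : ∀ᶠ δ : ℝ in nhdsWithin 0 (Set.Ioi 0), 0 < δ := self_mem_nhdsWithin
  have hA : Tendsto (fun δ : ℝ => 2 * √α * arctan (w / (√α * √δ)))
      (nhdsWithin 0 (Set.Ioi 0)) (nhds (Real.pi * √α)) := by
    have h1 : Tendsto (fun δ : ℝ => √α * √δ) (nhdsWithin 0 (Set.Ioi 0))
        (nhdsWithin 0 (Set.Ioi 0)) := by
      refine tendsto_nhdsWithin_iff.2 ⟨by simpa using hs0.const_mul (√α), ?_⟩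
      filter_upwards [hpos] with δ hδ
      exact mul_pos ha (Real.sqrt_pos.2 hδ)
    have h2 : Tendsto (fun δ : ℝ => w / (√α * √δ)) (nhdsWithin 0 (Set.Ioi 0)) atTop := by
      simpa only [div_eq_mul_inv, Function.comp_def] using (tendsto_inv_nhdsGT_zero.comp h1).const_mul_atTop hw
    have h3 := ((tendsto_nhds_of_tendsto_nhdsWithin tendsto_arctan_atTop).comp h2).const_mul
      (2 * √α)
    have e : Real.pi * √α = 2 * √α * (Real.pi / 2) := by ring
    rw [e]
    exact h3
  have hB : Tendsto (fun δ : ℝ => 2 * √α * arctan (w / (√α * √δ)) + √δ * (8 * w / α))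
      (nhdsWithin 0 (Set.Ioi 0)) (nhds (Real.pi * √α)) := by
    simpa using hA.add (hs0.mul_const (8 * w / α))
  have hmul : ∀ δ : ℝ, 0 < δ → √δ * (∫ x in Set.Ioo (-w) w, 1 / (δ + x ^ 2 / α)) =
      2 * √α * arctan (w / (√α * √δ)) := by
    intro δ hδ
    rw [neck_I α w δ hα hw hδ]
    have hs : 0 < √δ := Real.sqrt_pos.2 hδ
    field_simp
  refine tendsto_of_tendsto_of_tendsto_of_le_of_le' hA hB ?_ ?_
  · filter_upwards [hpos] with δ hδ
    rw [← hmul δ hδ, ← Real.sqrt_eq_rpow]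
    exact mul_le_mul_of_nonneg_left (hlo δ hδ) (Real.sqrt_nonneg _)
  · filter_upwards [hpos] with δ hδ
    rw [← hmul δ hδ, ← Real.sqrt_eq_rpow, ← mul_add]
    exact mul_le_mul_of_nonneg_left (hup δ hδ) (Real.sqrt_nonneg _)
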